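/- arXiv:math/0504279 — 2 statements merged into one kernel-verified Lean document; each statement's English description precedes it below -/
import Mathlib

section
/- Let G : ℝ² → ℝ² be a homeomorphism of the plane that is isotopic to the identity (in particular, orientation preserving), and suppose G possesses a non-wandering point, i.e., there exists x ∈ ℝ² such that for every open neighborhood U of x there is an integer n ≥ 1 with G^n(U) ∩ U ≠ ∅. Then G has a fixed point: there exists z ∈ ℝ² with G(z) = z. -/
open Filter Topology

/-- `H : ℝ → X → X` (restricted to parameters in `[0,1]`) is an isotopy from `f` to `g`:
jointly continuous, each time-`t` map with `t ∈ [0,1]` a homeomorphism, `H 0 = f`,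
`H 1 = g`. -/
def IsIsotopy {X : Type*} [TopologicalSpace X] (f g : X → X) (H : ℝ → X → X) : Prop :=
  Continuous (fun p : ℝ × X => H p.1 p.2) ∧
  (∀ t ∈ Set.Icc (0 : ℝ) 1, IsHomeomorph (H t)) ∧
  H 0 = f ∧ H 1 = g

/-- `f` is isotopic to the identity. -/
def IsotopicToId {X : Type*} [TopologicalSpace X] (f : X → X) : Prop :=
  ∃ H : ℝ → X → X, IsIsotopy id f H

/-- `x` is a non-wandering point of `G`: every open neighborhood `U` of `x` satisfies
`G^n(U) ∩ U ≠ ∅` for some `n ≥ 1`. -/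
def NonWandering {X : Type*} [TopologicalSpace X] (G : X → X) (x : X) : Prop :=
  ∀ U : Set X, IsOpen U → x ∈ U → ∃ n : ℕ, 1 ≤ n ∧ (G^[n] '' U ∩ U).Nonempty

open Metric unitInterval

/-- A self-map of the plane preserves orientation if the ratio `(h x - h y) / (x - y)` has a
continuous symmetric logarithm on the space of pairs of distinct points. -/
def PreservesOrientation (h : ℂ → ℂ) : Prop :=
  ∃ A : ℂ → ℂ → ℂ, ContinuousOn (fun p : ℂ × ℂ => A p.1 p.2) {p | p.1 ≠ p.2} ∧
    (∀ x y, A x y = A y x) ∧ ∀ x y, x ≠ y → h x - h y = Complex.exp (A x y) * (x - y)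

/-- An orientation preserving homeomorphism of the plane without fixed points. -/
def IsBrouwer (h : ℂ ≃ₜ ℂ) : Prop :=
  PreservesOrientation h ∧ ∀ z, h z ≠ z

/-- Some fixed point free orientation preserving homeomorphism of the plane has a point `p` with
`h^n p = p`. -/
def IsBrouwerPeriod (n : ℕ) : Prop :=
  1 ≤ n ∧ ∃ h : ℂ ≃ₜ ℂ, IsBrouwer h ∧ ∃ p, h^[n] p = p

/-- A homotopy in `ℂ \ {0}` starting at the constant `1` ends at a map having a continuous
logarithm, whose value at a point depends only on the track of that point. -/
lemma exists_continuous_log_of_homotopy {X : Type*} [TopologicalSpace X] (F : C(I × X, ℂ))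
    (hF : ∀ p, F p ≠ 0) (h0 : ∀ x, F (0, x) = 1) :
    ∃ A : C(X, ℂ), (∀ x, Complex.exp (A x) = F (1, x)) ∧
      ∀ x y, (∀ t, F (t, x) = F (t, y)) → A x = A y := by
  let F' : C(I × X, {z : ℂ // z ≠ 0}) := ⟨fun p => ⟨F p, hF p⟩, by fun_prop⟩
  have cov := Complex.isCoveringMap_exp
  have h0' : ∀ a, F' (0, a) = ⟨_, Complex.exp_ne_zero ((ContinuousMap.const X (0 : ℂ)) a)⟩ := by
    intro a
    apply Subtype.ext
    simp [F', h0]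
  let L := cov.liftHomotopy F' (ContinuousMap.const X (0 : ℂ)) h0'
  refine ⟨⟨fun x => L (1, x), by fun_prop⟩, fun x => ?_, fun x y hxy => ?_⟩
  · have := congrFun (cov.liftHomotopy_lifts F' (ContinuousMap.const X (0 : ℂ)) h0') (1, x)
    exact congrArg Subtype.val this
  · have : F'.comp ((ContinuousMap.id I).prodMk <| .const I x) =
        F'.comp ((ContinuousMap.id I).prodMk <| .const I y) := by
      ext t
      exact hxy t
    change L (1, x) = L (1, y)
    simp only [L, IsCoveringMap.liftHomotopy_apply]
    congr 1
    simp only [this]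
    rfl

lemma preservesOrientation_of_isotopy (H : ℝ → ℂ → ℂ)
    (hc : Continuous (fun p : ℝ × ℂ => H p.1 p.2))
    (hi : ∀ t ∈ Set.Icc (0 : ℝ) 1, Function.Injective (H t)) (h0 : H 0 = id) :
    PreservesOrientation (H 1) := by
  classical
  let X : Type := {p : ℂ × ℂ // p.1 ≠ p.2}
  have hc' : ∀ f : I × X → ℂ, Continuous f → Continuous fun q : I × X => H q.1 (f q) := by
    intro f hf
    exact hc.comp (by fun_prop : Continuous fun q : I × X => ((q.1 : ℝ), f q))
  have hne : ∀ x : X, x.1.1 - x.1.2 ≠ 0 := fun x => sub_ne_zero.2 x.2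
  let F : C(I × X, ℂ) := ⟨fun q => (H q.1 q.2.1.1 - H q.1 q.2.1.2) / (q.2.1.1 - q.2.1.2), by
    have hv : Continuous fun q : I × X => q.2.1 := continuous_subtype_val.comp continuous_snd
    exact ((hc' _ hv.fst).sub (hc' _ hv.snd)).div (hv.fst.sub hv.snd) fun q => hne q.2⟩
  obtain ⟨A, hA, hA'⟩ := exists_continuous_log_of_homotopy F
    (fun q => div_ne_zero (sub_ne_zero.2 fun h => q.2.2 (hi _ q.1.2 h)) (hne q.2))
    (fun x => by
      change (H 0 x.1.1 - H 0 x.1.2) / (x.1.1 - x.1.2) = 1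
      rw [h0]
      exact div_self (hne x))
  refine ⟨fun x y => if h : x ≠ y then A ⟨(x, y), h⟩ else 0, ?_, fun x y => ?_, fun x y h => ?_⟩
  · rw [continuousOn_iff_continuous_domRestrict]
    refine A.continuous.congr fun x => ?_
    have := x.2
    simp only [Set.domRestrict_apply]
    rw [dif_pos this]
  · dsimp only
    by_cases h : x = y
    · rw [h]
    · rw [dif_pos h, dif_pos (Ne.symm h)]
      refine hA' _ _ fun t => ?_
      change (H t x - H t y) / (x - y) = (H t y - H t x) / (y - x)
      rw [← neg_sub (H t y), ← neg_sub y x, neg_div_neg_eq]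
  · dsimp only
    rw [dif_pos h, hA]
    change H 1 x - H 1 y = (H 1 x - H 1 y) / (x - y) * (x - y)
    rw [div_mul_cancel₀ _ (sub_ne_zero.2 h)]

lemma PreservesOrientation.comp {g h : ℂ ≃ₜ ℂ} (hg : PreservesOrientation g)
    (hh : PreservesOrientation h) : PreservesOrientation (h.trans g) := by
  obtain ⟨A, hA, hAs, hAe⟩ := hg
  obtain ⟨B, hB, hBs, hBe⟩ := hh
  refine ⟨fun x y => A (h x) (h y) + B x y, ContinuousOn.add ?_ hB, fun x y => ?_,
    fun x y hxy => ?_⟩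
  · exact hA.comp (f := fun p : ℂ × ℂ => (h p.1, h p.2)) (by fun_prop)
      fun p hp => h.injective.ne hp
  · dsimp only
    rw [hAs, hBs]
  · simp only [Homeomorph.trans_apply]
    rw [hAe _ _ (h.injective.ne hxy), hBe _ _ hxy, Complex.exp_add, mul_assoc]

lemma PreservesOrientation.symm {g : ℂ ≃ₜ ℂ} (hg : PreservesOrientation g) :
    PreservesOrientation g.symm := by
  obtain ⟨A, hA, hAs, hAe⟩ := hg
  refine ⟨fun x y => - A (g.symm x) (g.symm y), ContinuousOn.neg ?_, fun x y => ?_,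
    fun x y hxy => ?_⟩
  · exact hA.comp (f := fun p : ℂ × ℂ => (g.symm p.1, g.symm p.2)) (by fun_prop)
      fun p hp => g.symm.injective.ne hp
  · dsimp only
    rw [hAs]
  · have := hAe _ _ (g.symm.injective.ne hxy)
    rw [g.apply_symm_apply, g.apply_symm_apply] at this
    rw [this, ← mul_assoc, ← Complex.exp_add]
    simp

lemma preservesOrientation_id : PreservesOrientation (Homeomorph.refl ℂ) :=
  ⟨fun _ _ => 0, continuousOn_const, fun _ _ => rfl, fun _ _ _ => by simp⟩

/-- A map whose difference from the identity is a contraction preserves orientation. -/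
lemma preservesOrientation_of_norm_sub_le {g : ℂ → ℂ} (hg : Continuous g) {c : ℝ} (hc : c < 1)
    (h : ∀ x y, ‖g x - g y - (x - y)‖ ≤ c * ‖x - y‖) : PreservesOrientation g := by
  have key : ∀ x y, x ≠ y → ‖(g x - g y) / (x - y) - 1‖ < 1 := by
    intro x y hxy
    have hn : x - y ≠ 0 := sub_ne_zero.2 hxy
    have : (g x - g y) / (x - y) - 1 = (g x - g y - (x - y)) / (x - y) := by
      rw [sub_div _ (x - y), div_self hn]
    rw [this, norm_div, div_lt_one (norm_pos_iff.2 hn)]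
    refine (h x y).trans_lt ?_
    have := norm_pos_iff.2 hn
    nlinarith
  have hs : ∀ x y, x ≠ y → (g x - g y) / (x - y) ∈ Complex.slitPlane := fun x y hxy =>
    Complex.ball_one_subset_slitPlane (by simpa [dist_eq_norm] using key x y hxy)
  refine ⟨fun x y => Complex.log ((g x - g y) / (x - y)), ?_, fun x y => ?_, fun x y hxy => ?_⟩
  · refine ContinuousOn.clog (ContinuousOn.div (by fun_prop) (by fun_prop) ?_)
      fun p hp => hs _ _ hp
    exact fun p hp => sub_ne_zero.2 hp
  · dsimp only
    rw [← neg_sub (g y), ← neg_sub y x, neg_div_neg_eq]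
  · rw [Complex.exp_log (Complex.slitPlane_ne_zero (hs x y hxy)),
      div_mul_cancel₀ _ (sub_ne_zero.2 hxy)]

/-- Inside a ball, the centre can be moved to any point by an orientation preserving
homeomorphism supported in the ball. -/
lemma exists_homeomorph_ball {a b : ℂ} {r : ℝ} (hb : b ∈ ball a r) :
    ∃ g : ℂ ≃ₜ ℂ, PreservesOrientation g ∧ g a = b ∧ ∀ z ∉ ball a r, g z = z := by
  have hr : 0 < r := pos_of_mem_ball hb
  rw [mem_ball, dist_eq_norm] at hb
  let φ : ℂ → ℝ := fun z => max 0 (1 - ‖z - a‖ / r)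
  let f : ℂ → ℂ := fun z => z + φ z * (b - a)
  have hφ : ∀ x y, |φ x - φ y| ≤ ‖x - y‖ / r := by
    intro x y
    have h1 : |φ x - φ y| ≤ |(1 - ‖x - a‖ / r) - (1 - ‖y - a‖ / r)| := by
      have := abs_max_sub_max_le_max (0 : ℝ) (1 - ‖x - a‖ / r) 0 (1 - ‖y - a‖ / r)
      simpa [φ] using this
    refine h1.trans ?_
    have h2 : (1 - ‖x - a‖ / r) - (1 - ‖y - a‖ / r) = (‖y - a‖ - ‖x - a‖) / r := by ring
    rw [h2, abs_div, abs_of_pos hr]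
    gcongr
    have := abs_norm_sub_norm_le (y - a) (x - a)
    rwa [sub_sub_sub_cancel_right, norm_sub_rev y x] at this
  have hf : ∀ x y, ‖f x - f y - (x - y)‖ ≤ ‖b - a‖ / r * ‖x - y‖ := by
    intro x y
    have : f x - f y - (x - y) = ((φ x - φ y : ℝ) : ℂ) * (b - a) := by
      simp only [f]; push_cast; ring
    rw [this, norm_mul, Complex.norm_real, Real.norm_eq_abs]
    calc |φ x - φ y| * ‖b - a‖ ≤ ‖x - y‖ / r * ‖b - a‖ := by gcongr; exact hφ x y
      _ = _ := by ring
  have hc : ‖b - a‖ / r < 1 := (div_lt_one hr).2 hb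
  have happ : ApproximatesLinearOn f ((ContinuousLinearEquiv.refl ℝ ℂ : ℂ ≃L[ℝ] ℂ) : ℂ →L[ℝ] ℂ)
      Set.univ (⟨‖b - a‖ / r, by positivity⟩ : NNReal) := by
    intro x _ y _
    exact hf x y
  have hN : (⟨‖b - a‖ / r, by positivity⟩ : NNReal) <
      ‖(((ContinuousLinearEquiv.refl ℝ ℂ).symm : ℂ ≃L[ℝ] ℂ) : ℂ →L[ℝ] ℂ)‖₊⁻¹ := by
    have : ‖(((ContinuousLinearEquiv.refl ℝ ℂ).symm : ℂ ≃L[ℝ] ℂ) : ℂ →L[ℝ] ℂ)‖₊ = 1 := by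
      ext
      exact ContinuousLinearMap.norm_id
    rw [this, inv_one]
    exact hc
  let g : ℂ ≃ₜ ℂ := happ.toHomeomorph f (Or.inr hN)
  have hgf : ∀ z, g z = f z := fun z => rfl
  refine ⟨g, preservesOrientation_of_norm_sub_le g.continuous hc fun x y => ?_, ?_, fun z hz => ?_⟩
  · rw [hgf, hgf]
    exact hf x y
  · rw [hgf]
    simp [f, φ]
  · have h1 : 1 - ‖z - a‖ / r ≤ 0 := by
      rw [mem_ball, dist_eq_norm, not_lt] at hz
      rw [sub_nonpos, one_le_div hr]
      exact hz
    rw [hgf]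
    simp [f, φ, max_eq_left h1]

/-- Points of a preconnected subset of an open set `V` can be moved to one another by orientation
preserving homeomorphisms supported in `V`. -/
lemma exists_homeomorph_of_isPreconnected {K V : Set ℂ} (hV : IsOpen V) (hK : IsPreconnected K)
    (hKV : K ⊆ V) {a b : ℂ} (ha : a ∈ K) (hb : b ∈ K) :
    ∃ g : ℂ ≃ₜ ℂ, PreservesOrientation g ∧ g a = b ∧ ∀ z ∉ V, g z = z := by
  refine hK.induction₂ (fun a b => ∃ g : ℂ ≃ₜ ℂ, PreservesOrientation g ∧ g a = b ∧
    ∀ z ∉ V, g z = z) (fun x hx => ?_) ?_ ?_ ha hb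
  · obtain ⟨r, hr, hrV⟩ := Metric.isOpen_iff.1 hV x (hKV hx)
    filter_upwards [mem_nhdsWithin_of_mem_nhds (ball_mem_nhds x hr)] with y hy
    obtain ⟨g, hg, hgx, hgs⟩ := exists_homeomorph_ball hy
    exact ⟨g, hg, hgx, fun z hz => hgs z fun h => hz (hrV h)⟩
  · rintro x y z - - - ⟨g, hg, rfl, hgs⟩ ⟨k, hk, rfl, hks⟩
    refine ⟨g.trans k, hk.comp hg, rfl, fun w hw => ?_⟩
    rw [Homeomorph.trans_apply, hgs w hw, hks w hw]
  · rintro x y - - ⟨g, hg, rfl, hgs⟩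
    refine ⟨g.symm, hg.symm, g.symm_apply_apply x, fun w hw => ?_⟩
    rw [Homeomorph.symm_apply_eq, hgs w hw]

/-- A fixed point free homeomorphism can be modified near a free continuum `K` so as to replace
the image value `a ∈ K` by `b ∈ K`, keeping the image values in a closed set off `K`. -/
lemma IsBrouwer.exists_modification {h : ℂ ≃ₜ ℂ} (hh : IsBrouwer h) {K F : Set ℂ}
    (hK : IsCompact K) (hKc : IsPreconnected K) (hfree : ∀ z ∈ K, h z ∉ K) (hF : IsClosed F)
    (hFK : ∀ z ∈ F, z ∉ K) {a b : ℂ} (ha : a ∈ K) (hb : b ∈ K) :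
    ∃ k : ℂ ≃ₜ ℂ, IsBrouwer k ∧ (∀ z, h z ∈ F → k z = h z) ∧ ∀ z, h z = a → k z = b := by
  have hdis : Disjoint K (h '' K) := by
    rw [Set.disjoint_right]
    rintro _ ⟨z, hz, rfl⟩
    exact hfree z hz
  obtain ⟨U, W, hU, hW, hKU, hKW, hUW⟩ :=
    SeparatedNhds.of_isCompact_isCompact hK (hK.image h.continuous) hdis
  let V := U ∩ h ⁻¹' W ∩ Fᶜ
  have hV : IsOpen V := (hU.inter (hW.preimage h.continuous)).inter hF.isOpen_compl
  have hKV : K ⊆ V := fun z hz =>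
    ⟨⟨hKU hz, hKW (Set.mem_image_of_mem h hz)⟩, fun hzF => hFK z hzF hz⟩
  have hVfree : ∀ z ∈ V, h z ∉ V := fun z hz hz' => Set.disjoint_left.1 hUW hz'.1.1 hz.1.2
  obtain ⟨g, hg, hgab, hgs⟩ := exists_homeomorph_of_isPreconnected hV hKc hKV ha hb
  refine ⟨h.trans g, ⟨hg.comp hh.1, fun z hz => ?_⟩, fun z hz => ?_, ?_⟩
  · rw [Homeomorph.trans_apply] at hz
    by_cases hzV : h z ∈ V
    · by_cases hz' : z ∈ V
      · exact hVfree z hz' hzV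
      · have := hgs z hz'
        have h2 := g.injective (hz.trans this.symm)
        exact hh.2 z h2
    · rw [hgs _ hzV] at hz
      exact hh.2 z hz
  · exact hgs _ fun hzV => hzV.2 hz
  · rintro z rfl
    exact hgab

/-- If the points `h^j q`, `0 < j < m`, are image values where `k` agrees with `h`, then the
orbits of `q` under `h` and `k` agree up to time `m - 1`. -/
lemma iterate_eq_of_eqOn_orbit {α : Type*} {h k : α → α} {q : α} {m : ℕ}
    (hk : ∀ j, 0 < j → j < m → ∀ z, h z = h^[j] q → k z = h z) :
    ∀ j < m, k^[j] q = h^[j] q := by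
  intro j
  induction j with
  | zero => intro _; rfl
  | succ j ih =>
    intro hj
    rw [Function.iterate_succ_apply', Function.iterate_succ_apply', ih (by omega)]
    exact hk (j + 1) (by omega) hj _ (by rw [Function.iterate_succ_apply'])

/-- Closing lemma: if an orbit returns to a free continuum avoiding a closed set, it can be closed
up without changing image values in that set. -/
lemma IsBrouwer.exists_closing {h : ℂ ≃ₜ ℂ} (hh : IsBrouwer h) {K F : Set ℂ} (hK : IsCompact K)
    (hKc : IsPreconnected K) (hfree : ∀ z ∈ K, h z ∉ K) (hF : IsClosed F) (hFK : ∀ z ∈ F, z ∉ K)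
    {q b : ℂ} (hb : b ∈ K) {m : ℕ} (hm : 1 ≤ m) (hmK : h^[m] q ∈ K)
    (hj : ∀ j, 0 < j → j < m → h^[j] q ∉ K) :
    ∃ k : ℂ ≃ₜ ℂ, IsBrouwer k ∧ (∀ z, h z ∈ F → k z = h z) ∧ k^[m] q = b := by
  let O : Set ℂ := (fun j => h^[j] q) '' Set.Ioo 0 m
  have hO : IsClosed O := ((Set.finite_Ioo 0 m).image _).isClosed
  obtain ⟨k, hk, hkF, hkb⟩ := hh.exists_modification hK hKc hfree (hF.union hO)
    (by
      rintro z (hz | ⟨j, hj', rfl⟩)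
      · exact hFK z hz
      · exact hj j hj'.1 hj'.2) hmK hb
  refine ⟨k, hk, fun z hz => hkF z (Or.inl hz), ?_⟩
  obtain ⟨m, rfl⟩ : ∃ l, m = l + 1 := ⟨m - 1, by omega⟩
  rw [Function.iterate_succ_apply', iterate_eq_of_eqOn_orbit (h := h) (m := m + 1) _ m (by omega)]
  · exact hkb _ (Function.iterate_succ_apply' h m q).symm
  · intro j h0 hjm z hz
    exact hkF z (Or.inr ⟨j, ⟨h0, hjm⟩, hz.symm⟩)

/-- A return to a free continuum produces a period not longer than the return time. -/
lemma IsBrouwer.exists_period {h : ℂ ≃ₜ ℂ} (hh : IsBrouwer h) {K : Set ℂ} (hK : IsCompact K)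
    (hKc : IsPreconnected K) (hfree : ∀ z ∈ K, h z ∉ K) {q : ℂ} (hq : q ∈ K) {m : ℕ}
    (hm : 1 ≤ m) (hmK : h^[m] q ∈ K) : ∃ n ≤ m, IsBrouwerPeriod n := by
  classical
  have hex : ∃ n, 1 ≤ n ∧ h^[n] q ∈ K := ⟨m, hm, hmK⟩
  obtain ⟨k, hk, -, hkq⟩ := hh.exists_closing hK hKc hfree isClosed_empty (by simp) hq
    (Nat.find_spec hex).1 (Nat.find_spec hex).2
    (fun j h0 hj hjK => Nat.find_min hex hj ⟨h0, hjK⟩)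
  exact ⟨Nat.find hex, Nat.find_min' hex ⟨hm, hmK⟩, (Nat.find_spec hex).1, k, hk, q, hkq⟩

lemma not_isBrouwerPeriod_one : ¬ IsBrouwerPeriod 1 := by
  rintro ⟨-, h, hh, p, hp⟩
  exact hh.2 p hp

lemma IsBrouwer.exists_log {h : ℂ ≃ₜ ℂ} (hh : IsBrouwer h) :
    ∃ θ : ℂ → ℂ, Continuous θ ∧ ∃ c ≠ 0, ∀ z, h z - z = Complex.exp (θ z) * c := by
  have hc : h 0 ≠ 0 := hh.2 0
  obtain ⟨A, hA, -⟩ := exists_continuous_log_of_homotopy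
    (⟨fun q => (h ((q.1 : ℝ) * q.2) - (q.1 : ℝ) * q.2) / h 0, by fun_prop⟩ : C(I × ℂ, ℂ))
    (fun q => div_ne_zero (sub_ne_zero.2 (hh.2 _)) hc) (fun x => by simp [hc])
  refine ⟨A, A.continuous, h 0, hc, fun z => ?_⟩
  rw [hA]
  simp [div_mul_cancel₀ _ hc]

/-- A continuous function on the plane with values in the kernel of `exp` is constant. -/
lemma eq_of_exp_eq_one {f : ℂ → ℂ} (hf : Continuous f) (h : ∀ z, Complex.exp (f z) = 1)
    (x y : ℂ) : f x = f y :=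
  congrFun (Complex.isCoveringMap_exp.eq_of_comp_eq hf (continuous_const (y := f y))
    (by ext z; simp [h]) y rfl) x

lemma not_isBrouwerPeriod_two : ¬ IsBrouwerPeriod 2 := by
  rintro ⟨-, h, hh, p, hp⟩
  obtain ⟨θ, hθ, c, hc, hθe⟩ := hh.exists_log
  obtain ⟨A, hA, hAs, hAe⟩ := hh.1
  have hp' : h (h p) = p := hp
  have hcont : Continuous fun z => θ (h z) - θ z - A z (h z) := by
    have : Continuous fun z => A z (h z) :=
      hA.comp_continuous (f := fun z => (z, h z)) (by fun_prop) fun z => (hh.2 z).symm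
    exact ((hθ.comp h.continuous).sub hθ).sub this
  have hexp : ∀ z, Complex.exp (θ (h z) - θ z - A z (h z)) = 1 := by
    intro z
    have h1 := hAe z (h z) (hh.2 z).symm
    have h2 : h (h z) - h z = Complex.exp (A z (h z)) * (h z - z) := by linear_combination -h1
    rw [hθe, hθe] at h2
    rw [Complex.exp_sub, Complex.exp_sub, div_div, div_eq_one_iff_eq
      (mul_ne_zero (Complex.exp_ne_zero _) (Complex.exp_ne_zero _))]
    apply mul_right_cancel₀ hc
    linear_combination h2
  have hconst := eq_of_exp_eq_one hcont hexp p (h p)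
  simp only [hp', hAs (h p) p] at hconst
  have h3 : θ (h p) = θ p := by linear_combination hconst / 2
  have h4 := hexp p
  rw [h3, sub_self, zero_sub, Complex.exp_neg, inv_eq_one] at h4
  have h5 := hAe p (h p) (hh.2 p).symm
  rw [h4, hp'] at h5
  exact hh.2 p (by linear_combination h5 / 2)

/-- The closed ball of radius `r` around `p` is critical for `h` at its point `y`: it meets its
image, `h y` lies in the ball, but only boundary points are mapped to the ball, and to its
boundary. -/
structure IsCriticalBall (h : ℂ → ℂ) (p : ℂ) (r : ℝ) (y : ℂ) : Prop where
  pos : 0 < r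
  dist_left : dist y p = r
  dist_right : dist (h y) p = r
  boundary : ∀ z, dist z p ≤ r → dist (h z) p ≤ r → dist z p = r ∧ dist (h z) p = r

lemma exists_isCriticalBall (h : ℂ ≃ₜ ℂ) {p : ℂ} (hp : h p ≠ p) :
    ∃ r y, IsCriticalBall h p r y := by
  have hcont : Continuous fun z => max (dist z p) (dist (h z) p) := by fun_prop
  obtain ⟨y, hy⟩ := hcont.exists_forall_le
    (tendsto_atTop_mono (fun z => le_max_left (dist z p) (dist (h z) p))
      (tendsto_dist_right_cocompact_atTop p))
  set r := max (dist y p) (dist (h y) p) with hr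
  have hpos : 0 < r := by
    by_contra hneg
    have h1 : dist y p ≤ 0 := (le_max_left _ _).trans (not_lt.1 hneg)
    have h2 : dist (h y) p ≤ 0 := (le_max_right _ _).trans (not_lt.1 hneg)
    rw [dist_le_zero] at h1 h2
    rw [h1] at h2
    exact hp h2
  have hmin : ∀ z, dist z p < r → dist (h z) p < r → False := fun z h1 h2 =>
    absurd (hy z) (not_le.2 (max_lt h1 h2))
  have mem_closure : ∀ z, dist z p ≤ r → z ∈ closure (ball p r) := fun z hz => by
    rw [closure_ball p hpos.ne']
    exact hz
  have hbd : ∀ z, dist z p ≤ r → dist (h z) p ≤ r → dist z p = r ∧ dist (h z) p = r := by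
    intro z h1 h2
    refine ⟨h1.antisymm (not_lt.1 fun hlt => ?_), h2.antisymm (not_lt.1 fun hlt => ?_)⟩
    · obtain ⟨w, hw, hwb⟩ := mem_closure_iff.1 (mem_closure _ h2) (h.symm ⁻¹' ball p r)
        (isOpen_ball.preimage h.symm.continuous) (by simpa using hlt)
      exact hmin (h.symm w) hw (by simpa using hwb)
    · obtain ⟨w, hw, hwb⟩ := mem_closure_iff.1 (mem_closure _ h1) (h ⁻¹' ball p r)
        (isOpen_ball.preimage h.continuous) hlt
      exact hmin w hwb hw
  obtain ⟨h1, h2⟩ := hbd y (le_max_left _ _) (le_max_right _ _)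
  exact ⟨r, y, hpos, h1, h2, hbd⟩

lemma dist_le_of_mem_segment {p a z : ℂ} (hz : z ∈ segment ℝ p a) : dist z p ≤ dist a p := by
  have := (convex_closedBall p (dist a p)).segment_subset (mem_closedBall_self dist_nonneg)
    (mem_closedBall.2 le_rfl) hz
  exact this

lemma eq_of_mem_segment_of_dist_le {p a z : ℂ} (hz : z ∈ segment ℝ p a)
    (h : dist a p ≤ dist z p) : z = a := by
  rw [segment_eq_image_lineMap] at hz
  obtain ⟨t, ht, rfl⟩ := hz
  rw [dist_lineMap_left, dist_comm p a, Real.norm_of_nonneg ht.1] at h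
  by_cases h0 : dist a p = 0
  · rw [dist_eq_zero] at h0
    simp [h0]
  · have : 0 < dist a p := lt_of_le_of_ne dist_nonneg (Ne.symm h0)
    have ht1 : t = 1 := le_antisymm ht.2 (by nlinarith)
    simp [ht1]

lemma eq_of_mem_segment_inter {p a b z : ℂ} (hab : dist a p = dist b p) (hne : a ≠ b)
    (ha : z ∈ segment ℝ p a) (hb : z ∈ segment ℝ p b) : z = p := by
  rw [segment_eq_image_lineMap] at ha hb
  obtain ⟨s, hs, rfl⟩ := ha
  obtain ⟨t, ht, hst⟩ := hb
  have h1 : dist (AffineMap.lineMap p b t) p = dist (AffineMap.lineMap p a s) p := by rw [hst]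
  rw [dist_lineMap_left, dist_lineMap_left, dist_comm p a, dist_comm p b, hab,
    Real.norm_of_nonneg hs.1, Real.norm_of_nonneg ht.1] at h1
  by_cases h0 : dist b p = 0
  · rw [h0] at hab
    exact absurd ((dist_eq_zero.1 hab).trans (dist_eq_zero.1 h0).symm) hne
  have hts : t = s := mul_right_cancel₀ h0 h1
  subst hts
  by_cases ht0 : t = 0
  · simp [ht0]
  · rw [AffineMap.lineMap_apply_module', AffineMap.lineMap_apply_module'] at hst
    have := smul_right_injective ℂ ht0 (add_right_cancel hst)
    exact absurd (sub_left_injective this).symm hne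

lemma isCompact_segment (a b : ℂ) : IsCompact (segment ℝ a b) := by
  rw [segment_eq_image_lineMap]
  exact isCompact_Icc.image AffineMap.lineMap_continuous

/-- The segment from the centre of a critical ball to `h y` is disjoint from
the second image of the segment to `y`. -/
lemma IsCriticalBall.iterate_two_notMem {h : ℂ ≃ₜ ℂ} (hh : IsBrouwer h) {p y : ℂ} {r : ℝ}
    (hc : IsCriticalBall h p r y) {u : ℂ} (hu : u ∈ segment ℝ p y) :
    h (h u) ∉ segment ℝ p (h y) := by
  intro hu2
  have hyne : h y ≠ y := hh.2 y
  have hdy : dist y p = dist (h y) p := hc.dist_left.trans hc.dist_right.symm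
  have sub1 : segment ℝ p u ⊆ segment ℝ p y :=
    (convex_segment p y).segment_subset (left_mem_segment ℝ p y) hu
  have sub2 : segment ℝ p (h (h u)) ⊆ segment ℝ p (h y) :=
    (convex_segment p (h y)).segment_subset (left_mem_segment ℝ p (h y)) hu2
  have hend : ∀ z ∈ segment ℝ p u ∪ segment ℝ p (h (h u)), dist z p = r →
      (z = y ∧ u = y) ∨ (z = h y ∧ h (h u) = h y) := by
    rintro z (hz | hz) hzr
    · left
      exact ⟨eq_of_mem_segment_of_dist_le (sub1 hz) (by rw [hc.dist_left, hzr]),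
        eq_of_mem_segment_of_dist_le hu
          (by rw [hc.dist_left, ← hzr]; exact dist_le_of_mem_segment hz)⟩
    · right
      exact ⟨eq_of_mem_segment_of_dist_le (sub2 hz) (by rw [hc.dist_right, hzr]),
        eq_of_mem_segment_of_dist_le hu2
          (by rw [hc.dist_right, ← hzr]; exact dist_le_of_mem_segment hz)⟩
  have hball : ∀ z ∈ segment ℝ p u ∪ segment ℝ p (h (h u)), dist z p ≤ r := by
    rintro z (hz | hz)
    · exact (dist_le_of_mem_segment (sub1 hz)).trans hc.dist_left.le
    · exact (dist_le_of_mem_segment (sub2 hz)).trans hc.dist_right.le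
  have hfree : ∀ z ∈ segment ℝ p u ∪ segment ℝ p (h (h u)),
      h z ∉ segment ℝ p u ∪ segment ℝ p (h (h u)) := by
    intro z hz hhz
    obtain ⟨hz1, hz2⟩ := hc.boundary z (hball z hz) (hball _ hhz)
    rcases hend z hz hz1 with ⟨rfl, h1⟩ | ⟨rfl, h1⟩ <;>
      rcases hend _ hhz hz2 with ⟨h2, h3⟩ | ⟨h2, h3⟩
    · exact hh.2 _ h2
    · subst h1
      exact hh.2 _ h3
    · exact not_isBrouwerPeriod_two ⟨by norm_num, h, hh, y, h2⟩
    · exact hh.2 _ h2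
  obtain ⟨n, hn, hper⟩ := hh.exists_period (m := 2)
    ((isCompact_segment p u).union (isCompact_segment p (h (h u))))
    ((convex_segment p u).isPreconnected.union p (left_mem_segment ℝ _ _)
      (left_mem_segment ℝ _ _) (convex_segment p _).isPreconnected) hfree
    (Or.inl (right_mem_segment ℝ p u)) (by norm_num) (Or.inr (right_mem_segment ℝ p _))
  have hn1 := hper.1
  interval_cases n
  · exact not_isBrouwerPeriod_one hper
  · exact not_isBrouwerPeriod_two hper

/-- When no period is less than `n`, a point `w` of the segment from the centre `p` of a critical
ball to `y` is not mapped to `p` by `h^n`. -/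
lemma IsCriticalBall.iterate_ne {n : ℕ} (hn : 2 ≤ n) (hmin : ∀ m < n, ¬ IsBrouwerPeriod m)
    {h : ℂ ≃ₜ ℂ} (hh : IsBrouwer h) {p y : ℂ} {r : ℝ} (hc : IsCriticalBall h p r y) {w : ℂ}
    (hw : w ∈ segment ℝ p y) (hwp : w ≠ p) : h^[n] w ≠ p := by
  intro hnw
  have hdy : dist y p = dist (h y) p := hc.dist_left.trans hc.dist_right.symm
  have sub : segment ℝ w y ⊆ segment ℝ p y :=
    (convex_segment p y).segment_subset hw (right_mem_segment ℝ p y)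
  have hball1 : ∀ z ∈ segment ℝ p y, dist z p ≤ r := fun z hz =>
    (dist_le_of_mem_segment hz).trans hc.dist_left.le
  have hball2 : ∀ z ∈ segment ℝ p (h y), dist z p ≤ r := fun z hz =>
    (dist_le_of_mem_segment hz).trans hc.dist_right.le
  have hend1 : ∀ z ∈ segment ℝ p y, dist z p = r → z = y := fun z hz hzr =>
    eq_of_mem_segment_of_dist_le hz (by rw [hc.dist_left, hzr])
  have hend2 : ∀ z ∈ segment ℝ p (h y), dist z p = r → z = h y := fun z hz hzr =>
    eq_of_mem_segment_of_dist_le hz (by rw [hc.dist_right, hzr])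
  have hp : p ∉ segment ℝ w y := fun hp => hwp <| by
    rw [segment_eq_image_lineMap] at hw
    obtain ⟨t, ht, rfl⟩ := hw
    by_contra hne
    have hyp : y ≠ p := fun h0 => hc.pos.ne (by rw [← hc.dist_left, h0, dist_self])
    have h1 := dist_add_dist_of_mem_segment hp
    rw [dist_lineMap_left, dist_lineMap_right, Real.norm_of_nonneg ht.1,
      Real.norm_of_nonneg (sub_nonneg.2 ht.2)] at h1
    have h2 : 0 < dist p y := dist_pos.2 hyp.symm
    have ht0 : t = 0 := by nlinarith [ht.1]
    exact hne (by simp [ht0])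
  have hfree : ∀ z ∈ segment ℝ p (h y) ∪ h '' segment ℝ w y,
      h z ∉ segment ℝ p (h y) ∪ h '' segment ℝ w y := by
    rintro z (hz | ⟨z, hz, rfl⟩) (hz' | ⟨z', hz', hzz⟩)
    · obtain ⟨h1, h2⟩ := hc.boundary z (hball2 z hz) (hball2 _ hz')
      exact hh.2 z ((hend2 _ hz' h2).trans (hend2 z hz h1).symm)
    · obtain rfl := h.injective hzz
      obtain rfl := eq_of_mem_segment_inter hdy (hh.2 y).symm (sub hz') hz
      exact hp hz'
    · exact hc.iterate_two_notMem hh (sub hz) hz'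
    · obtain rfl := h.injective hzz
      obtain ⟨h1, h2⟩ := hc.boundary z (hball1 z (sub hz)) (hball1 _ (sub hz'))
      exact hh.2 z ((hend1 _ (sub hz') h2).trans (hend1 z (sub hz) h1).symm)
  obtain ⟨m, hm, hper⟩ := hh.exists_period (m := n - 1) (q := h w)
    ((isCompact_segment p (h y)).union ((isCompact_segment w y).image h.continuous))
    ((convex_segment p (h y)).isPreconnected.union (h y) (right_mem_segment ℝ _ _)
      (Set.mem_image_of_mem h (right_mem_segment ℝ _ _))
      ((convex_segment w y).isPreconnected.image h h.continuous.continuousOn)) hfree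
    (Or.inr (Set.mem_image_of_mem h (left_mem_segment ℝ w y))) (by omega)
    (Or.inl (by
      rw [← Function.iterate_succ_apply, Nat.succ_eq_add_one, Nat.sub_add_cancel (by omega), hnw]
      exact left_mem_segment ℝ p _))
  exact hmin m (by omega) hper

/-- An orientation preserving homeomorphism of the plane without fixed points has no periodic
points. -/
theorem not_isBrouwerPeriod (n : ℕ) : ¬ IsBrouwerPeriod n := by
  induction n using Nat.strong_induction_on with
  | _ n hmin =>
  rintro ⟨hn1, h, hh, p, hp⟩
  have hn : 2 ≤ n := by
    by_contra hlt
    obtain rfl : n = 1 := by omega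
    exact hh.2 p hp
  obtain ⟨r, y, hc⟩ := exists_isCriticalBall h (hh.2 p)
  have hr2 : r / 2 < r := half_lt_self hc.pos
  have hfree : ∀ z ∈ closedBall p (r / 2), h z ∉ closedBall p (r / 2) := fun z hz hz' =>
    absurd (hc.boundary z ((mem_closedBall.1 hz).trans hr2.le)
      ((mem_closedBall.1 hz').trans hr2.le)).1 ((mem_closedBall.1 hz).trans_lt hr2).ne
  have hyp : y ≠ p := fun h0 => hc.pos.ne (by rw [← hc.dist_left, h0, dist_self])
  obtain ⟨w, hw, hwp, hwD, hwn⟩ : ∃ w ∈ segment ℝ p y, w ≠ p ∧ w ∈ closedBall p (r / 2) ∧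
      h^[n] w ∈ closedBall p (r / 2) := by
    have hD : closedBall p (r / 2) ∈ 𝓝 p := closedBall_mem_nhds p (half_pos hc.pos)
    have hl : Tendsto (fun t : ℝ => AffineMap.lineMap p y t) (𝓝[>] 0) (𝓝 p) := by
      have : Continuous fun t : ℝ => (AffineMap.lineMap p y t : ℂ) := AffineMap.lineMap_continuous
      have h1 := this.tendsto 0
      rw [AffineMap.lineMap_apply_zero] at h1
      exact h1.mono_left nhdsWithin_le_nhds
    have hl2 : Tendsto (fun t : ℝ => h^[n] (AffineMap.lineMap p y t)) (𝓝[>] 0) (𝓝 p) := by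
      have h1 := (h.continuous.iterate n).tendsto p
      rw [hp] at h1
      exact h1.comp hl
    obtain ⟨t, ⟨h1, h2⟩, ht⟩ := ((hl.eventually hD).and (hl2.eventually hD)).and
      (Ioo_mem_nhdsGT (zero_lt_one (α := ℝ))) |>.exists
    refine ⟨AffineMap.lineMap p y t, ?_, ?_, h1, h2⟩
    · rw [segment_eq_image_lineMap]
      exact Set.mem_image_of_mem _ ⟨ht.1.le, ht.2.le⟩
    · rw [Ne, AffineMap.lineMap_eq_left_iff, not_or]
      exact ⟨hyp.symm, ht.1.ne'⟩
  have hDc : IsPreconnected (closedBall p (r / 2)) := (convex_closedBall p _).isPreconnected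
  have hD : IsCompact (closedBall p (r / 2)) := isCompact_closedBall p _
  obtain ⟨k, hk, hkh, hkn⟩ := hh.exists_closing hD hDc hfree
    ((isCompact_closedBall p r).image h.continuous).isClosed
    (by
      rintro _ ⟨z, hz, rfl⟩ hz'
      exact absurd (hc.boundary z hz ((mem_closedBall.1 hz').trans hr2.le)).2
        ((mem_closedBall.1 hz').trans_lt hr2).ne)
    (mem_closedBall_self (half_pos hc.pos).le) hn1 hwn
    (fun j h0 hj hjD => by
      obtain ⟨m, hm, hper⟩ := hh.exists_period hD hDc hfree hwD h0 hjD
      exact hmin m (hm.trans_lt hj) hper)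
  have hkh' : ∀ z, dist z p ≤ r → k z = h z := fun z hz =>
    hkh z (Set.mem_image_of_mem h (mem_closedBall.2 hz))
  have hck : IsCriticalBall k p r y :=
    ⟨hc.pos, hc.dist_left, by rw [hkh' y hc.dist_left.le, hc.dist_right], fun z hz => by
      rw [hkh' z hz]
      exact hc.boundary z hz⟩
  exact hck.iterate_ne hn hmin hk hw hwp hkn

/-- **Fathi's theorem** (first assertion): an orientation preserving (here: isotopic to
the identity) homeomorphism of the plane with a non-wandering point has a fixed point. -/
theorem fixed_point_of_nonwandering
    (G : ℝ × ℝ → ℝ × ℝ) (hG : IsHomeomorph G) (hGiso : IsotopicToId G)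
    (x : ℝ × ℝ) (hx : NonWandering G x) :
    ∃ z : ℝ × ℝ, G z = z := by
  by_contra! hfix
  obtain ⟨H, hHc, hHh, hH0, hH1⟩ := hGiso
  let e : ℝ × ℝ ≃ₜ ℂ := Complex.equivRealProdCLM.symm.toHomeomorph
  let h : ℂ ≃ₜ ℂ := (e.symm.trans (hG.homeomorph G)).trans e
  have hiter : ∀ (n : ℕ) z, h^[n] (e z) = e (G^[n] z) := by
    intro n z
    refine (Function.Semiconj.iterate_right (f := e) (ga := G) (gb := h) (fun z => ?_) n z).symm
    change e (G z) = e (G (e.symm (e z)))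
    rw [e.symm_apply_apply]
  have hh : IsBrouwer h := by
    constructor
    · have hor := preservesOrientation_of_isotopy (fun t z => e (H t (e.symm z)))
        (e.continuous.comp (hHc.comp
          (by fun_prop : Continuous fun p : ℝ × ℂ => (p.1, e.symm p.2))))
        (fun t ht => e.injective.comp ((hHh t ht).injective.comp e.symm.injective))
        (by ext z; simp [hH0])
      simp only [hH1] at hor
      exact hor
    · intro z hz
      exact hfix (e.symm z) (e.injective (hz.trans (e.apply_symm_apply z).symm))
  obtain ⟨r, y, hc⟩ := exists_isCriticalBall h (hh.2 (e x))
  have hr2 : r / 2 < r := half_lt_self hc.pos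
  obtain ⟨n, hn, _, ⟨u, hu, rfl⟩, hu'⟩ := hx (e ⁻¹' ball (e x) (r / 2))
    (isOpen_ball.preimage e.continuous) (mem_ball_self (half_pos hc.pos))
  obtain ⟨m, -, hm⟩ := hh.exists_period (isCompact_closedBall (e x) (r / 2))
    (convex_closedBall _ _).isPreconnected
    (fun z hz hz' => absurd (hc.boundary z ((mem_closedBall.1 hz).trans hr2.le)
      ((mem_closedBall.1 hz').trans hr2.le)).1 ((mem_closedBall.1 hz).trans_lt hr2).ne)
    (ball_subset_closedBall hu) hn (by
      rw [hiter]
      exact ball_subset_closedBall hu')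
  exact not_isBrouwerPeriod m hm
end

section
/- Let f : T² → T² be a homeomorphism of the torus T² = ℝ²/ℤ² that is isotopic to the identity, and let F : ℝ² → ℝ² be a lift of f satisfying F(z + m) = F(z) + m for all z ∈ ℝ² and m ∈ ℤ². Let p, r, q, t be integers with q ≥ 1, t ≥ 1, and suppose there is a point x̃ ∈ ℝ² with F^{qt}(x̃) = x̃ + (pt, rt). Then there exists a point ỹ ∈ ℝ² with F^q(ỹ) = ỹ + (p, r); that is, if f has a periodic point with rotation vector (p/q, r/q) realized at period qt, then f has a periodic point of period q whose lift is translated exactly by (p, r) under F^q. -/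
open Filter Topology

/-- The torus `ℝ²/ℤ²`, realized as a product of two circles `ℝ/ℤ`. -/
abbrev Torus := AddCircle (1 : ℝ) × AddCircle (1 : ℝ)

/-- The covering projection `π : ℝ² → T²`. -/
noncomputable def torusProj : ℝ × ℝ → Torus :=
  fun z => ((z.1 : AddCircle (1 : ℝ)), (z.2 : AddCircle (1 : ℝ)))

/-- The inclusion of the integer lattice `ℤ²` into `ℝ²`. -/
def intVec (m : ℤ × ℤ) : ℝ × ℝ := ((m.1 : ℝ), (m.2 : ℝ))

/-- `F` commutes with the integer translations: `F (z + m) = F z + m` for `m ∈ ℤ²`. -/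
def CommutesWithIntTranslations (F : ℝ × ℝ → ℝ × ℝ) : Prop :=
  ∀ (z : ℝ × ℝ) (m : ℤ × ℤ), F (z + intVec m) = F z + intVec m

/-- `F : ℝ² → ℝ²` is a lift of `f : T² → T²`: it is a homeomorphism with `π ∘ F = f ∘ π`. -/
def IsLiftOf (F : ℝ × ℝ → ℝ × ℝ) (f : Torus → Torus) : Prop :=
  IsHomeomorph F ∧ ∀ z : ℝ × ℝ, torusProj (F z) = f (torusProj z)

/-- `x` is a periodic point of `f` of least period `q`. -/
def HasLeastPeriod {X : Type*} (f : X → X) (x : X) (q : ℕ) : Prop :=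
  f^[q] x = x ∧ ∀ d : ℕ, 0 < d → d < q → f^[d] x ≠ x

/-- The `f`-orbit of the periodic point `x` is topologically monotone (of finite
order type): there are a homeomorphism `g` and an isotopy from `f` to `g` fixing every
point of the orbit of `x` (i.e. agreeing with `f` there at all times), with `g^k = id`
for some `k ≥ 1`. -/
def TopologicallyMonotoneOrbit {X : Type*} [TopologicalSpace X] (f : X → X) (x : X) : Prop :=
  ∃ (g : X → X) (H : ℝ → X → X), IsIsotopy f g H ∧
    (∀ t ∈ Set.Icc (0 : ℝ) 1, ∀ n : ℕ, H t (f^[n] x) = f (f^[n] x)) ∧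
    ∃ k : ℕ, 1 ≤ k ∧ g^[k] = id

/-- `h` is the time-one map of a continuous family of injective maps starting at the identity. -/
def InjIsotopicToId {X : Type*} [TopologicalSpace X] (h : X → X) : Prop :=
  ∃ H : ℝ → X → X, Continuous (fun p : ℝ × X => H p.1 p.2) ∧
    (∀ t ∈ Set.Icc (0 : ℝ) 1, Function.Injective (H t)) ∧ H 0 = id ∧ H 1 = h

namespace InjIsotopicToId

variable {X Y : Type*} [TopologicalSpace X] [TopologicalSpace Y]

theorem refl : InjIsotopicToId (id : X → X) :=
  ⟨fun _ => id, continuous_snd, fun _ _ => Function.injective_id, rfl, rfl⟩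

theorem comp {g h : X → X} (hg : InjIsotopicToId g) (hh : InjIsotopicToId h) :
    InjIsotopicToId (g ∘ h) := by
  obtain ⟨G, hGc, hGi, hG0, hG1⟩ := hg
  obtain ⟨H, hHc, hHi, hH0, hH1⟩ := hh
  refine ⟨fun t => G t ∘ H t, hGc.comp (continuous_fst.prodMk hHc),
    fun t ht => (hGi t ht).comp (hHi t ht), ?_, ?_⟩
  · simp [hG0, hH0]
  · simp [hG1, hH1]

theorem iterate {h : X → X} (hh : InjIsotopicToId h) (n : ℕ) : InjIsotopicToId h^[n] := by
  induction n with
  | zero => exact refl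
  | succ n ih => exact ih.comp hh

theorem conj {h : X → X} (hh : InjIsotopicToId h) (e : X ≃ₜ Y) :
    InjIsotopicToId (e ∘ h ∘ e.symm) := by
  obtain ⟨H, hHc, hHi, hH0, hH1⟩ := hh
  refine ⟨fun t => e ∘ H t ∘ e.symm, ?_, fun t ht => ?_, ?_, ?_⟩
  · exact e.continuous.comp
      (hHc.comp (continuous_fst.prodMk (e.symm.continuous.comp continuous_snd)))
  · exact e.injective.comp ((hHi t ht).comp e.symm.injective)
  · ext x; simp [hH0]
  · simp [hH1]

theorem add_const {E : Type*} [NormedAddCommGroup E] [NormedSpace ℝ E] (c : E) :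
    InjIsotopicToId (fun z : E => z + c) := by
  refine ⟨fun t z => z + t • c, by fun_prop, fun t _ => add_left_injective _, ?_, ?_⟩
  · ext; simp
  · ext; simp

end InjIsotopicToId

theorem exists_continuous_exp_eq {A : Type*} [TopologicalSpace A] [SimplyConnectedSpace A]
    [LocallyPathConnectedSpace A] {w : A → ℂ} (hw : Continuous w) (h0 : ∀ a, w a ≠ 0) :
    ∃ L : A → ℂ, Continuous L ∧ ∀ a, Complex.exp (L a) = w a := by
  obtain ⟨a₀⟩ : Nonempty A := inferInstance
  obtain ⟨L, ⟨-, hL⟩, -⟩ := Complex.isCoveringMap_exp.existsUnique_continuousMap_lifts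
    (⟨fun a => ⟨w a, h0 a⟩, by fun_prop⟩ : C(A, {z : ℂ // z ≠ 0})) a₀ (Complex.log (w a₀))
    (Subtype.ext (Complex.exp_log (h0 a₀)))
  exact ⟨L, L.continuous, fun a => congrArg Subtype.val (congrFun hL a)⟩

theorem eq_of_exp_eq_const {A : Type*} [TopologicalSpace A] [PreconnectedSpace A] {f : A → ℂ}
    (hf : Continuous f) {c : ℂ} (h : ∀ a, Complex.exp (f a) = c) (a b : A) : f a = f b :=
  Complex.isCoveringMap_exp.const_of_comp hf (fun x y => Subtype.ext ((h x).trans (h y).symm)) a b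

/-- An isotopic-to-the-identity injection of the plane with a point of period two has a
fixed point. -/
theorem InjIsotopicToId.exists_fixed_of_period_two {h : ℂ → ℂ} (hh : InjIsotopicToId h) {p : ℂ}
    (hp : h (h p) = p) : ∃ z, h z = z := by
  by_contra! hfix
  obtain ⟨H, hHc, hHi, hH0, hH1⟩ := hh
  have hc : Continuous h := by
    rw [← hH1]; exact hHc.comp (continuous_const.prodMk continuous_id)
  obtain ⟨L, hLc, hL⟩ := exists_continuous_exp_eq (w := fun z => h z - z) (by fun_prop)
    (fun z => sub_ne_zero.2 (hfix z))
  set γ : ℝ → ℂ := fun s => p + s * (h p - p) with hγ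
  have hγc : Continuous γ := by fun_prop
  have hγ0 : γ 0 = p := by simp [hγ]
  have hγ1 : γ 1 = h p := by simp [hγ]
  set c : ℝ → ℝ := fun t => Set.projIcc (0 : ℝ) 1 zero_le_one t with hcdef
  have hcc : Continuous c := continuous_subtype_val.comp continuous_projIcc
  have hc0 : c 0 = 0 := by simp [hcdef]
  have hc1 : c 1 = 1 := by simp [hcdef]
  have hcI : ∀ t, c t ∈ Set.Icc (0 : ℝ) 1 := fun t => (Set.projIcc (0 : ℝ) 1 zero_le_one t).2
  obtain ⟨M, hMc, hM⟩ := exists_continuous_exp_eq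
    (w := fun x : ℝ × ℝ => H (c x.1) (h (γ x.2)) - H (c x.1) (γ x.2))
    ((hHc.comp ((hcc.comp continuous_fst).prodMk (hc.comp (hγc.comp continuous_snd)))).sub
      (hHc.comp ((hcc.comp continuous_fst).prodMk (hγc.comp continuous_snd))))
    (fun x => sub_ne_zero.2 fun e => hfix _ (hHi _ (hcI _) e))
  have e0 : M (0, 0) - L p = M (0, 1) - L (h p) := by
    have := eq_of_exp_eq_const (f := fun s : ℝ => M (0, s) - L (γ s)) (c := 1) (by fun_prop)
      (fun s => by
        rw [Complex.exp_sub, hM, hL]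
        simp only [hc0, hH0, id]
        exact div_self (sub_ne_zero.2 (hfix _))) 0 1
    simpa [hγ0, hγ1] using this
  have e1 : M (1, 0) - L (h p) = M (1, 1) - L p := by
    have := eq_of_exp_eq_const (f := fun s : ℝ => M (1, s) - L (h (γ s))) (c := 1) (by fun_prop)
      (fun s => by
        rw [Complex.exp_sub, hM, hL]
        simp only [hc1, hH1]
        exact div_self (sub_ne_zero.2 (hfix _))) 0 1
    simpa [hγ0, hγ1, hp] using this
  have e2 : M (0, 1) - M (0, 0) = M (1, 1) - M (1, 0) := by
    refine eq_of_exp_eq_const (f := fun t : ℝ => M (t, 1) - M (t, 0)) (c := -1) (by fun_prop)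
      (fun t => ?_) 0 1
    rw [Complex.exp_sub, hM, hM]
    simp only [hγ0, hγ1, hp]
    rw [← neg_sub, neg_div, div_self (sub_ne_zero.2 fun e => hfix _ (hHi _ (hcI _) e))]
  have e3 : L p = L (h p) := by linear_combination (e1 - e0 - e2) / 2
  have e4 : h p - p = p - h p := by
    rw [← hL p, e3, hL, hp]
  exact hfix p (by linear_combination e4 / 2)

/-- The centre of a ball can be pushed to any other point of the ball by a homeomorphism supported
in the ball and isotopic to the identity. -/
theorem exists_push_of_ball {a b : ℂ} {ρ : ℝ} (hb : b ∈ Metric.ball a ρ) :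
    ∃ φ : ℂ → ℂ, IsHomeomorph φ ∧ InjIsotopicToId φ ∧ φ a = b ∧
      ∀ z ∉ Metric.ball a ρ, φ z = z := by
  have hρ : 0 < ρ := Metric.pos_of_mem_ball hb
  rw [Metric.mem_ball, dist_eq_norm] at hb
  set c : ℂ → ℝ := fun z => max 0 (1 - ‖z - a‖ / ρ) with hcdef
  have hcc : Continuous c := by fun_prop
  have hclip : ∀ z w, |c z - c w| ≤ ‖z - w‖ / ρ := fun z w => by
    calc |c z - c w| ≤ |(1 - ‖z - a‖ / ρ) - (1 - ‖w - a‖ / ρ)| := by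
          simpa using abs_max_sub_max_le_max 0 (1 - ‖z - a‖ / ρ) 0 (1 - ‖w - a‖ / ρ)
      _ = |‖w - a‖ - ‖z - a‖| / ρ := by
          rw [← abs_of_pos hρ, ← abs_div, abs_of_pos hρ]; congr 1; ring
      _ ≤ ‖z - w‖ / ρ := by
          gcongr
          simpa [norm_sub_rev] using abs_norm_sub_norm_le (w - a) (z - a)
  set k : ℝ := ‖b - a‖ / ρ with hk
  have hk0 : 0 ≤ k := by positivity
  have hk1 : k < 1 := (div_lt_one hρ).2 hb
  have hlip : ∀ t ∈ Set.Icc (0 : ℝ) 1, ∀ z w,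
      ‖(t * c z : ℝ) • (b - a) - (t * c w : ℝ) • (b - a)‖ ≤ k * ‖z - w‖ := fun t ht z w => by
    rw [← sub_smul, ← mul_sub, norm_smul, Real.norm_eq_abs, abs_mul, abs_of_nonneg ht.1]
    calc t * |c z - c w| * ‖b - a‖ ≤ 1 * (‖z - w‖ / ρ) * ‖b - a‖ := by
          gcongr
          · exact ht.2
          · exact hclip z w
      _ = k * ‖z - w‖ := by rw [hk]; ring
  set Φ : ℝ → ℂ → ℂ := fun t z => z + (t * c z : ℝ) • (b - a) with hΦ
  have hinj : ∀ t ∈ Set.Icc (0 : ℝ) 1, Function.Injective (Φ t) := fun t ht z w hzw => by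
    by_contra hne
    have h1 : z - w = -((t * c z : ℝ) • (b - a) - (t * c w : ℝ) • (b - a)) := by
      simp only [hΦ] at hzw
      linear_combination hzw
    have h2 := hlip t ht z w
    rw [← norm_neg, ← h1] at h2
    have : 0 < ‖z - w‖ := norm_pos_iff.2 (sub_ne_zero.2 hne)
    nlinarith
  have happ : ApproximatesLinearOn (Φ 1) ((ContinuousLinearEquiv.refl ℝ ℂ : ℂ ≃L[ℝ] ℂ) : ℂ →L[ℝ] ℂ)
      Set.univ (⟨k, hk0⟩ : NNReal) := by
    intro z _ w _
    have e : Φ 1 z - Φ 1 w - (z - w) = (1 * c z : ℝ) • (b - a) - (1 * c w : ℝ) • (b - a) := by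
      simp only [hΦ]
      ring
    change ‖Φ 1 z - Φ 1 w - (z - w)‖ ≤ k * ‖z - w‖
    rw [e]
    exact hlip 1 (by simp) z w
  refine ⟨Φ 1, (happ.toHomeomorph _ (Or.inr ?_)).isHomeomorph,
    ⟨Φ, by fun_prop, hinj, ?_, rfl⟩, ?_, ?_⟩
  · have : ‖((ContinuousLinearEquiv.refl ℝ ℂ).symm : ℂ →L[ℝ] ℂ)‖₊ = 1 := by
      simp
    rw [this, inv_one]
    exact hk1
  · ext z; simp [hΦ]
  · simp [hΦ, hcdef]
  · intro z hz
    have : c z = 0 := by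
      rw [Metric.mem_ball, dist_eq_norm, not_lt] at hz
      exact max_eq_left (by rw [sub_nonpos]; exact (one_le_div hρ).2 hz)
    simp [hΦ, this]

/-- Inside a connected open set, any point can be pushed to any other one by a homeomorphism
supported in that set and isotopic to the identity. -/
theorem exists_push {S : Set ℂ} (hSo : IsOpen S) (hS : IsPreconnected S) {a b : ℂ}
    (ha : a ∈ S) (hb : b ∈ S) :
    ∃ φ : ℂ → ℂ, IsHomeomorph φ ∧ InjIsotopicToId φ ∧ φ a = b ∧ ∀ z ∉ S, φ z = z := by
  refine hS.induction₂' (fun a b => ∃ φ : ℂ → ℂ, IsHomeomorph φ ∧ InjIsotopicToId φ ∧ φ a = b ∧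
    ∀ z ∉ S, φ z = z) (fun x hx => ?_) ?_ ha hb
  · obtain ⟨ρ, hρ, hsub⟩ := Metric.isOpen_iff.1 hSo x hx
    have : ∀ᶠ y in 𝓝[S] x, y ∈ Metric.ball x (ρ / 2) :=
      mem_nhdsWithin_of_mem_nhds (Metric.ball_mem_nhds x (half_pos hρ))
    filter_upwards [this] with y hy
    constructor
    · obtain ⟨φ, h1, h2, h3, h4⟩ := exists_push_of_ball hy
      exact ⟨φ, h1, h2, h3, fun z hz => h4 z fun h =>
        hz (hsub (Metric.ball_subset_ball (half_le_self hρ.le) h))⟩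
    · obtain ⟨φ, h1, h2, h3, h4⟩ := exists_push_of_ball (Metric.mem_ball_comm.1 hy)
      exact ⟨φ, h1, h2, h3, fun z hz => h4 z fun h => hz (hsub (Metric.ball_subset_ball' (by
        rw [Metric.mem_ball] at hy; linarith) h))⟩
  · rintro x y z - - - ⟨φ, h1, h2, h3, h4⟩ ⟨ψ, g1, g2, g3, g4⟩
    exact ⟨ψ ∘ φ, g1.comp h1, g2.comp h2, by simp [h3, g3], fun z hz => by simp [h4 z hz, g4 z hz]⟩

theorem iterate_comp_eq_of_notMem {X : Type*} {φ h : X → X} {U : Set X}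
    (hφ : ∀ z ∉ U, φ z = z) {x : X} {n : ℕ} (hx : ∀ i, 0 < i → i < n → h^[i] x ∉ U) :
    ∀ i < n, (φ ∘ h)^[i] x = h^[i] x := by
  intro i
  induction i with
  | zero => simp
  | succ i ih =>
    intro hi
    rw [Function.iterate_succ_apply', ih (by omega), Function.comp_apply,
      ← Function.iterate_succ_apply' h, hφ _ (hx _ (by omega) hi)]

theorem iterate_comp_eq_apply_iterate {X : Type*} {φ h : X → X} {U : Set X}
    (hφ : ∀ z ∉ U, φ z = z) {x : X} {n : ℕ} (hn : 0 < n)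
    (hx : ∀ i, 0 < i → i < n → h^[i] x ∉ U) : (φ ∘ h)^[n] x = φ (h^[n] x) := by
  obtain ⟨m, rfl⟩ : ∃ m, n = m + 1 := ⟨n - 1, by omega⟩
  rw [Function.iterate_succ_apply', iterate_comp_eq_of_notMem hφ hx m (by omega),
    Function.comp_apply, ← Function.iterate_succ_apply' h]

/-- Composing with an injection supported in a free set creates no fixed points. -/
theorem comp_ne_of_free {X : Type*} {φ h : X → X} {U : Set X} (hφi : Function.Injective φ)
    (hφ : ∀ z ∉ U, φ z = z) (hU : ∀ z ∈ U, h z ∉ U) (hfix : ∀ z, h z ≠ z) (z : X) :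
    (φ ∘ h) z ≠ z := by
  intro e
  by_cases hz : z ∈ U
  · rw [Function.comp_apply, hφ _ (hU z hz)] at e
    exact hfix z e
  · exact hfix z (hφi (e.trans (hφ z hz).symm))

/-- The fixed point free plane homeomorphisms isotopic to the identity through injections. -/
structure IsFreePlaneHomeo (h : ℂ → ℂ) : Prop where
  isHomeomorph : IsHomeomorph h
  isotopic : InjIsotopicToId h
  ne_self : ∀ z, h z ≠ z

namespace IsFreePlaneHomeo

variable {h : ℂ → ℂ}

/-- If a point of a free connected open set `U` returns to `U` after `k` iterations, then a
perturbation supported in `U` has a periodic point of period at most `k`. -/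
theorem exists_periodic_of_return (hh : IsFreePlaneHomeo h) {U : Set ℂ} (hUo : IsOpen U)
    (hUc : IsPreconnected U) (hU : ∀ z ∈ U, h z ∉ U) {z : ℂ} (hz : z ∈ U) {k : ℕ} (hk : 0 < k)
    (hkz : h^[k] z ∈ U) :
    ∃ j, 0 < j ∧ j ≤ k ∧ ∃ g, IsFreePlaneHomeo g ∧ ∃ w, g^[j] w = w := by
  classical
  have hex : ∃ j, 0 < j ∧ h^[j] z ∈ U := ⟨k, hk, hkz⟩
  obtain ⟨hj0, hjz⟩ := Nat.find_spec hex
  have hjmin : ∀ i, 0 < i → i < Nat.find hex → h^[i] z ∉ U :=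
    fun i hi hlt hmem => Nat.find_min hex hlt ⟨hi, hmem⟩
  obtain ⟨φ, h1, h2, h3, h4⟩ := exists_push hUo hUc hjz hz
  refine ⟨_, hj0, Nat.find_le ⟨hk, hkz⟩, φ ∘ h, ⟨h1.comp hh.isHomeomorph, h2.comp hh.isotopic,
    comp_ne_of_free h1.injective h4 hU hh.ne_self⟩, z, ?_⟩
  rw [iterate_comp_eq_apply_iterate h4 hj0 hjmin, h3]

/-- Around every point there is a maximal free ball: some boundary point is mapped to the
boundary. -/
theorem exists_critical_ball (hh : IsFreePlaneHomeo h) (x : ℂ) :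
    ∃ y r, 0 < r ∧ (∀ z ∈ Metric.ball x r, h z ∉ Metric.ball x r) ∧ dist y x = r ∧
      dist (h y) x = r := by
  have hc := hh.isHomeomorph.continuous
  obtain ⟨y, hy⟩ := Continuous.exists_forall_le (f := fun z => max (dist z x) (dist (h z) x))
    (by fun_prop) (tendsto_atTop_mono (fun z => le_max_left (dist z x) (dist (h z) x))
      (tendsto_dist_right_cocompact_atTop x))
  set r := max (dist y x) (dist (h y) x) with hr
  have hfree : ∀ z ∈ Metric.ball x r, h z ∉ Metric.ball x r := fun z hz hz' =>
    (hy z).not_gt (max_lt hz hz')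
  have hr0 : 0 < r := by
    by_contra hle
    have h1 : y = x := dist_le_zero.1 ((le_max_left _ _).trans (not_lt.1 hle))
    have h2 : h y = x := dist_le_zero.1 ((le_max_right _ _).trans (not_lt.1 hle))
    exact hh.ne_self y (h2.trans h1.symm)
  have hcl := closure_ball x hr0.ne'
  refine ⟨y, r, hr0, hfree, ?_, ?_⟩
  · by_contra hne
    have hyB : y ∈ Metric.ball x r := lt_of_le_of_ne (le_max_left _ _) hne
    have hmem : h y ∈ closure (Metric.ball x r) := by rw [hcl, Metric.mem_closedBall]; exact le_max_right _ _
    obtain ⟨_, ⟨z, hz, rfl⟩, hz'⟩ := mem_closure_iff.1 hmem _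
      (hh.isHomeomorph.isOpenMap _ Metric.isOpen_ball) (Set.mem_image_of_mem h hyB)
    exact hfree z hz hz'
  · by_contra hne
    have hyB : h y ∈ Metric.ball x r := lt_of_le_of_ne (le_max_right _ _) hne
    have hmem : y ∈ closure (Metric.ball x r) := by rw [hcl, Metric.mem_closedBall]; exact le_max_left _ _
    obtain ⟨z, hz, hz'⟩ := mem_closure_iff.1 hmem _ (Metric.isOpen_ball.preimage hc) hyB
    exact hfree z hz' hz

end IsFreePlaneHomeo

/-- A compact connected set disjoint from its image has a connected open neighbourhood with the
same property. -/
theorem exists_open_free_superset {g : ℂ → ℂ} (hg : Continuous g) {K : Set ℂ} (hK : IsCompact K)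
    (hKc : IsConnected K) (hfree : ∀ z ∈ K, g z ∉ K) :
    ∃ V, IsOpen V ∧ IsPreconnected V ∧ K ⊆ V ∧ ∀ z ∈ V, g z ∉ V := by
  obtain ⟨O₁, O₂, ho₁, ho₂, hs₁, hs₂, hd⟩ := SeparatedNhds.of_isCompact_isCompact hK
    (hK.image hg) (Set.disjoint_right.2 (by rintro _ ⟨z, hz, rfl⟩; exact hfree z hz))
  obtain ⟨a, ha⟩ := hKc.nonempty
  have hsub : K ⊆ O₁ ∩ g ⁻¹' O₂ := fun z hz => ⟨hs₁ hz, hs₂ (Set.mem_image_of_mem g hz)⟩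
  refine ⟨connectedComponentIn (O₁ ∩ g ⁻¹' O₂) a,
    (ho₁.inter (ho₂.preimage hg)).connectedComponentIn, isPreconnected_connectedComponentIn,
    hKc.isPreconnected.subset_connectedComponentIn ha hsub, fun z hz hz' => ?_⟩
  exact Set.disjoint_left.1 hd (connectedComponentIn_subset _ _ hz').1
    (connectedComponentIn_subset _ _ hz).2

namespace IsFreePlaneHomeo

/-- **Brouwer's lemma**: a fixed point free plane homeomorphism isotopic to the identity has no
periodic points. -/
theorem iterate_ne_self {h₀ : ℂ → ℂ} (hh₀ : IsFreePlaneHomeo h₀) {n₀ : ℕ} (hn₀ : 0 < n₀) (x₀ : ℂ) :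
    h₀^[n₀] x₀ ≠ x₀ := by
  classical
  intro hx₀
  have hex : ∃ n, 0 < n ∧ ∃ g, IsFreePlaneHomeo g ∧ ∃ w, g^[n] w = w :=
    ⟨n₀, hn₀, h₀, hh₀, x₀, hx₀⟩
  obtain ⟨n, ⟨hn, h, hh, x, hx⟩, hmin⟩ : ∃ n, (0 < n ∧ ∃ g, IsFreePlaneHomeo g ∧ ∃ w, g^[n] w = w) ∧
      ∀ m < n, ¬ (0 < m ∧ ∃ g, IsFreePlaneHomeo g ∧ ∃ w, g^[m] w = w) :=
    ⟨Nat.find hex, Nat.find_spec hex, fun m hm => Nat.find_min hex hm⟩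
  have hnoret : ∀ {g : ℂ → ℂ}, IsFreePlaneHomeo g → ∀ {U : Set ℂ}, IsOpen U → IsPreconnected U →
      (∀ z ∈ U, g z ∉ U) → ∀ z ∈ U, ∀ k, 0 < k → k < n → g^[k] z ∉ U := by
    intro g hg U hUo hUc hU z hz k hk hkn hkz
    obtain ⟨j, hj0, hjk, hj⟩ := hg.exists_periodic_of_return hUo hUc hU hz hk hkz
    exact hmin j (by omega) ⟨hj0, hj⟩
  have hn3 : 3 ≤ n := by
    by_contra hlt
    obtain rfl | rfl : n = 1 ∨ n = 2 := by omega
    · exact hh.ne_self x hx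
    · obtain ⟨z, hz⟩ := hh.isotopic.exists_fixed_of_period_two (p := x) hx
      exact hh.ne_self z hz
  obtain ⟨y, r, hr, hfree, hyr, hhyr⟩ := hh.exists_critical_ball x
  set B := Metric.ball x r with hB
  have hBo : IsOpen B := Metric.isOpen_ball
  have hBc : IsPreconnected B := (convex_ball x r).isPreconnected
  have hxB : x ∈ B := Metric.mem_ball_self hr
  have hinj := hh.isHomeomorph.injective
  have hcl := closure_ball x hr.ne'
  have hD : ∀ f : ℂ → ℂ, IsOpenMap f → (∀ z ∈ B, f z ∉ B) → ∀ z ∈ B, ¬ dist (f z) x ≤ r := by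
    intro f hf hfB z hz hle
    have hmem : f z ∈ closure B := by rw [hcl]; exact hle
    obtain ⟨_, ⟨w, hw, rfl⟩, hw'⟩ := mem_closure_iff.1 hmem _ (hf _ hBo)
      (Set.mem_image_of_mem f hz)
    exact hfB w hw hw'
  have hD1 := hD h hh.isHomeomorph.isOpenMap hfree
  have hD2 := hD (h ∘ h) (hh.isHomeomorph.comp hh.isHomeomorph).isOpenMap
    (fun z hz => hnoret hh hBo hBc hfree z hz 2 (by omega) (by omega))
  have hhyB : h y ∉ B := fun hm => (Metric.mem_ball.1 hm).ne hhyr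
  have hyB : y ∉ B := fun hm => (Metric.mem_ball.1 hm).ne hyr
  have hhhyB : h (h y) ∉ B := by
    intro hm
    have hmem : y ∈ closure B := by rw [hcl]; exact hyr.le
    obtain ⟨z, hz, hz'⟩ := mem_closure_iff.1 hmem _
      (hBo.preimage (hh.isHomeomorph.comp hh.isHomeomorph).continuous) hm
    exact hD2 z hz' (Metric.ball_subset_closedBall hz)
  set x' := x + (1 / 2 : ℝ) • (h y - x) with hx'
  have hrad : ∀ {w : ℂ}, dist w x = r → ∀ s : ℝ, 0 ≤ s → dist (x + s • (w - x)) x = s * r := by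
    intro w hw s hs
    rw [dist_eq_norm, add_sub_cancel_left, norm_smul, ← dist_eq_norm, hw, Real.norm_eq_abs,
      abs_of_nonneg hs]
  have hseg1 : ∀ z ∈ segment ℝ x' (h y), z = h y ∨
      z ∈ B ∧ ∃ s : ℝ, 0 < s ∧ z = x + s • (h y - x) := by
    intro z hz
    rw [segment_eq_image'] at hz
    obtain ⟨u, ⟨hu0, hu1⟩, rfl⟩ := hz
    have e : x' + u • (h y - x') = x + (1 / 2 + u / 2) • (h y - x) := by
      simp only [hx', Complex.real_smul]; push_cast; ring
    rcases hu1.eq_or_lt with rfl | hu1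
    · left; simp
    · right
      simp only [e]
      refine ⟨?_, _, by linarith, rfl⟩
      rw [hB, Metric.mem_ball, hrad hhyr _ (by linarith)]
      nlinarith
  have hseg2 : ∀ z ∈ segment ℝ y x, z = y ∨
      z ∈ B ∧ ∃ s : ℝ, 0 ≤ s ∧ z = x + s • (y - x) := by
    intro z hz
    rw [segment_symm, segment_eq_image'] at hz
    obtain ⟨u, ⟨hu0, hu1⟩, rfl⟩ := hz
    rcases hu1.eq_or_lt with rfl | hu1
    · left; simp
    · right
      refine ⟨?_, u, hu0, rfl⟩
      rw [hB, Metric.mem_ball, hrad hyr _ hu0]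
      nlinarith
  have hdisj : ∀ z ∈ segment ℝ x' (h y), z ∉ segment ℝ y x := by
    intro z hz hz'
    rcases hseg1 z hz with rfl | ⟨hzB, s, hs, hzs⟩
    · rcases hseg2 _ hz' with e | ⟨hm, -⟩
      · exact hh.ne_self y e
      · exact hhyB hm
    · rcases hseg2 _ hz' with rfl | ⟨-, u, hu, hzu⟩
      · exact hyB hzB
      · have e1 := hrad hhyr s hs.le
        have e2 := hrad hyr u hu
        rw [← hzs] at e1
        rw [← hzu] at e2
        obtain rfl : s = u := mul_right_cancel₀ hr.ne' (e1.symm.trans e2)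
        have e3 := add_left_cancel (hzs.symm.trans hzu)
        exact hh.ne_self y (sub_left_injective (smul_right_injective ℂ hs.ne' e3))
  have hx'seg : x' ∈ segment ℝ x' (h y) := left_mem_segment ..
  have hx'B : x' ∈ B := by
    rcases hseg1 _ hx'seg with e | e
    · have := hrad hhyr (1 / 2) (by norm_num)
      rw [← hx', e, hhyr] at this
      linarith
    · exact e.1
  obtain ⟨ψ, ψ1, ψ2, ψ3, ψ4⟩ := exists_push hBo hBc hxB hx'B
  have hg : IsFreePlaneHomeo (ψ ∘ h) := ⟨ψ1.comp hh.isHomeomorph, ψ2.comp hh.isotopic,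
    comp_ne_of_free ψ1.injective ψ4 hfree hh.ne_self⟩
  have hret : ∀ i, 0 < i → i < n → h^[i] x ∉ B := hnoret hh hBo hBc hfree x hxB
  have hgx : (ψ ∘ h)^[n - 1] (h x) = x' := by
    have e1 : (ψ ∘ h) x = h x :=
      iterate_comp_eq_of_notMem ψ4 hret 1 (by omega)
    rw [← e1, ← Function.iterate_succ_apply, show (n - 1).succ = n by omega,
      iterate_comp_eq_apply_iterate ψ4 hn hret, hx, ψ3]
  set K := segment ℝ x' (h y) ∪ h '' segment ℝ y x with hK
  have hc := hh.isHomeomorph.continuous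
  have hKcomp : IsCompact K := by
    have hs : ∀ a b : ℂ, IsCompact (segment ℝ a b) := fun a b => by
      rw [segment_eq_image']
      exact isCompact_Icc.image (by fun_prop)
    exact (hs _ _).union ((hs _ _).image hc)
  have hKconn : IsConnected K := by
    refine ⟨⟨x', Or.inl hx'seg⟩, IsPreconnected.union (h y) (right_mem_segment ..)
      (Set.mem_image_of_mem h (left_mem_segment ..)) (convex_segment _ _).isPreconnected
      ((convex_segment _ _).isPreconnected.image h hc.continuousOn)⟩
  have hKfree : ∀ z ∈ K, (ψ ∘ h) z ∉ K := by
    have hclosed : ∀ w ∈ segment ℝ x' (h y), dist w x ≤ r := by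
      intro w hw
      rcases hseg1 w hw with rfl | ⟨hwB, -⟩
      · exact hhyr.le
      · exact (Metric.mem_ball.1 hwB).le
    rintro z (hz | ⟨z, hz, rfl⟩)
    · have hzB : h z ∉ B := by
        rcases hseg1 z hz with rfl | ⟨hzB, -⟩
        · exact hhhyB
        · exact hfree z hzB
      rw [Function.comp_apply, ψ4 _ hzB]
      rintro (hm | ⟨w, hw, e⟩)
      · rcases hseg1 z hz with rfl | ⟨hzB', -⟩
        · rcases hseg1 _ hm with e | ⟨e, -⟩
          · exact hh.ne_self _ e
          · exact hhhyB e
        · exact hD1 z hzB' (hclosed _ hm)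
      · exact hdisj z hz (hinj e ▸ hw)
    · have hzB : h (h z) ∉ B := by
        rcases hseg2 z hz with rfl | ⟨hzB, -⟩
        · exact hhhyB
        · exact hnoret hh hBo hBc hfree z hzB 2 (by omega) (by omega)
      rw [Function.comp_apply, ψ4 _ hzB]
      rintro (hm | ⟨w, hw, e⟩)
      · rcases hseg2 z hz with rfl | ⟨hzB', -⟩
        · rcases hseg1 _ hm with e | ⟨e, -⟩
          · exact hh.ne_self _ e
          · exact hhhyB e
        · exact hD2 z hzB' (hclosed _ hm)
      · have e' := hinj e
        subst e'
        rcases hseg2 z hz with rfl | ⟨hzB', -⟩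
        · rcases hseg2 _ hw with e | ⟨e, -⟩
          · exact hh.ne_self _ e
          · exact hhyB e
        · rcases hseg2 _ hw with e | ⟨e, -⟩
          · exact hD1 z hzB' (by rw [e, hyr])
          · exact hfree z hzB' e
  obtain ⟨V, hVo, hVc, hKV, hVfree⟩ :=
    exists_open_free_superset hg.isHomeomorph.continuous hKcomp hKconn hKfree
  refine hnoret hg hVo hVc hVfree (h x)
    (hKV (Or.inr (Set.mem_image_of_mem h (right_mem_segment ..)))) (n - 1) (by omega) (by omega) ?_
  rw [hgx]
  exact hKV (Or.inl hx'seg)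

end IsFreePlaneHomeo

theorem sub_eq_sub_of_torusProj_eq {A : Type*} [TopologicalSpace A] [PreconnectedSpace A]
    {f g : A → ℝ × ℝ} (hf : Continuous f) (hg : Continuous g)
    (h : ∀ a, torusProj (f a) = torusProj (g a)) (a b : A) : f a - g a = f b - g b := by
  have h1 : ∀ a, (((f a).1 - (g a).1 : ℝ) : AddCircle (1 : ℝ)) = 0 := fun a => by
    rw [AddCircle.coe_sub, sub_eq_zero]; exact congrArg Prod.fst (h a)
  have h2 : ∀ a, (((f a).2 - (g a).2 : ℝ) : AddCircle (1 : ℝ)) = 0 := fun a => by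
    rw [AddCircle.coe_sub, sub_eq_zero]; exact congrArg Prod.snd (h a)
  exact Prod.ext
    ((AddCircle.isCoveringMap_coe (1 : ℝ)).const_of_comp (g := fun a => (f a).1 - (g a).1)
      (by fun_prop) (fun a b => (h1 a).trans (h1 b).symm) a b)
    ((AddCircle.isCoveringMap_coe (1 : ℝ)).const_of_comp (g := fun a => (f a).2 - (g a).2)
      (by fun_prop) (fun a b => (h2 a).trans (h2 b).symm) a b)

theorem exists_addCircle_lift {A : Type*} [TopologicalSpace A] [SimplyConnectedSpace A]
    [LocallyPathConnectedSpace A] {w : A → AddCircle (1 : ℝ)} (hw : Continuous w) {a₀ : A} {e₀ : ℝ}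
    (h : (e₀ : AddCircle (1 : ℝ)) = w a₀) :
    ∃ L : A → ℝ, Continuous L ∧ L a₀ = e₀ ∧ ∀ a, (L a : AddCircle (1 : ℝ)) = w a := by
  obtain ⟨L, ⟨h0, hL⟩, -⟩ :=
    (AddCircle.isCoveringMap_coe (1 : ℝ)).existsUnique_continuousMap_lifts ⟨w, hw⟩ a₀ e₀ h
  exact ⟨L, L.continuous, h0, congrFun hL⟩

theorem continuous_torusProj : Continuous torusProj :=
  ((AddCircle.continuous_mk' 1).comp continuous_fst).prodMk
    ((AddCircle.continuous_mk' 1).comp continuous_snd)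

theorem exists_torus_homotopy_lift {H : ℝ → Torus → Torus}
    (hH : Continuous fun p : ℝ × Torus => H p.1 p.2) (hH0 : H 0 = id) :
    ∃ G : ℝ → ℝ × ℝ → ℝ × ℝ, Continuous (fun p : ℝ × (ℝ × ℝ) => G p.1 p.2) ∧ G 0 = id ∧
      ∀ t z, torusProj (G t z) = H t (torusProj z) := by
  have hw : Continuous fun x : ℝ × (ℝ × ℝ) => H x.1 (torusProj x.2) :=
    hH.comp (continuous_fst.prodMk (continuous_torusProj.comp continuous_snd))
  obtain ⟨L₁, hc1, h01, hL1⟩ := exists_addCircle_lift (continuous_fst.comp hw)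
    (a₀ := (0, (0, 0))) (e₀ := 0) (by simp [hH0, torusProj])
  obtain ⟨L₂, hc2, h02, hL2⟩ := exists_addCircle_lift (continuous_snd.comp hw)
    (a₀ := (0, (0, 0))) (e₀ := 0) (by simp [hH0, torusProj])
  have hproj : ∀ t z, torusProj (L₁ (t, z), L₂ (t, z)) = H t (torusProj z) :=
    fun t z => Prod.ext (hL1 (t, z)) (hL2 (t, z))
  refine ⟨fun t z => (L₁ (t, z), L₂ (t, z)), by fun_prop, ?_, hproj⟩
  ext1 z
  have := sub_eq_sub_of_torusProj_eq (f := fun z : ℝ × ℝ => (L₁ (0, z), L₂ (0, z))) (g := id)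
    (by fun_prop) continuous_id (fun z => by rw [hproj, hH0]; rfl) z (0, 0)
  simp only [h01, h02, id, sub_self] at this
  exact sub_eq_zero.1 this

theorem InjIsotopicToId.of_isLiftOf {f : Torus → Torus} (hf : IsotopicToId f) {F : ℝ × ℝ → ℝ × ℝ}
    (hF : IsLiftOf F f) : InjIsotopicToId F := by
  obtain ⟨H, hHc, hHi, hH0, hH1⟩ := hf
  obtain ⟨G, hGc, hG0, hG⟩ := exists_torus_homotopy_lift hHc hH0
  have hGt : ∀ z, Continuous fun t => G t z := fun z =>
    hGc.comp (continuous_id.prodMk continuous_const)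
  have hGinj : ∀ t ∈ Set.Icc (0 : ℝ) 1, Function.Injective (G t) := by
    intro t ht z w hzw
    have hπ : torusProj z = torusProj w := (hHi t ht).injective (by rw [← hG, ← hG, hzw])
    have := sub_eq_sub_of_torusProj_eq (hGt z) (hGt w)
      (fun s => by rw [hG, hG, hπ]) t 0
    rw [hzw, sub_self, hG0] at this
    exact (sub_eq_zero.1 this.symm)
  have hconst : ∀ z, F z - G 1 z = F 0 - G 1 0 := fun z =>
    sub_eq_sub_of_torusProj_eq (g := G 1) hF.1.continuous (hGc.comp (continuous_const.prodMk continuous_id))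
      (fun z => by rw [hF.2, hG, hH1]) z 0
  have : F = (fun z => z + (F 0 - G 1 0)) ∘ G 1 := by
    ext1 z
    rw [Function.comp_apply, ← hconst z, add_sub_cancel]
  rw [this]
  exact (add_const _).comp ⟨G, hGc, hGinj, hG0, rfl⟩

theorem CommutesWithIntTranslations.iterate {F : ℝ × ℝ → ℝ × ℝ}
    (hF : CommutesWithIntTranslations F) (n : ℕ) : CommutesWithIntTranslations F^[n] := by
  induction n with
  | zero => intro z m; rfl
  | succ n ih => intro z m; rw [Function.iterate_succ_apply, hF, ih, Function.iterate_succ_apply]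

theorem CommutesWithIntTranslations.iterate_sub {F : ℝ × ℝ → ℝ × ℝ}
    (hF : CommutesWithIntTranslations F) (m : ℤ × ℤ) (n : ℕ) (z : ℝ × ℝ) :
    (fun z => F z + -intVec m)^[n] z = F^[n] z + -((n : ℝ) • intVec m) := by
  have hsub : ∀ z, F (z + -intVec m) = F z + -intVec m := fun z => by
    have := hF (z + -intVec m) m
    rw [neg_add_cancel_right] at this
    rw [this, add_neg_cancel_right]
  have hcomm : Function.Commute F (fun z => z + -intVec m) := hsub
  change ((fun z => z + -intVec m) ∘ F)^[n] z = _
  rw [hcomm.symm.comp_iterate, Function.comp_apply, add_right_iterate_apply]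
  simp [Nat.cast_smul_eq_nsmul]

theorem isHomeomorph_iterate {X : Type*} [TopologicalSpace X] {f : X → X} (hf : IsHomeomorph f)
    (n : ℕ) : IsHomeomorph f^[n] := by
  induction n with
  | zero => exact IsHomeomorph.id
  | succ n ih => exact ih.comp hf

/-- Reduction step of the Main Theorem: if a torus homeomorphism `f` isotopic to the
identity has a point whose lift satisfies `F^{qt}(xlift) = xlift + (pt, rt)`, then there is a
point `ylift` with `F^q(ylift) = ylift + (p, r)`. -/
theorem reduce_ptrtqt_orbit_to_prq_orbit
    (f : Torus → Torus) (hf : IsHomeomorph f) (hfiso : IsotopicToId f)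
    (F : ℝ × ℝ → ℝ × ℝ) (hlift : IsLiftOf F f) (hcomm : CommutesWithIntTranslations F)
    (p r : ℤ) (q t : ℕ) (hq : 1 ≤ q) (ht : 1 ≤ t)
    (xlift : ℝ × ℝ) (hx : F^[q * t] xlift = xlift + intVec (p * (t : ℤ), r * (t : ℤ))) :
    ∃ ylift : ℝ × ℝ, F^[q] ylift = ylift + intVec (p, r) := by
  by_contra! hne
  set G : ℝ × ℝ → ℝ × ℝ := fun z => F^[q] z + -intVec (p, r) with hG
  have hGhomeo : IsHomeomorph G :=
    (Homeomorph.addRight (-intVec (p, r))).isHomeomorph.comp (isHomeomorph_iterate hlift.1 q)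
  have hGiso : InjIsotopicToId G :=
    (InjIsotopicToId.add_const (-intVec (p, r))).comp
      ((InjIsotopicToId.of_isLiftOf hfiso hlift).iterate q)
  have hGx : G^[t] xlift = xlift := by
    rw [hG, (hcomm.iterate q).iterate_sub, ← Function.iterate_mul, hx]
    ext <;> simp [intVec] <;> ring
  let e : ℝ × ℝ ≃ₜ ℂ := Complex.equivRealProdCLM.symm.toHomeomorph
  have hfree : IsFreePlaneHomeo (e ∘ G ∘ e.symm) :=
    ⟨e.isHomeomorph.comp (hGhomeo.comp e.symm.isHomeomorph), hGiso.conj e, fun z hz =>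
      hne (e.symm z) (by
        have : G (e.symm z) = e.symm z := by
          simpa using congrArg e.symm hz
        exact add_neg_eq_iff_eq_add.1 this)⟩
  have hsemi : Function.Semiconj e G (e ∘ G ∘ e.symm) := fun z => by simp
  refine hfree.iterate_ne_self (n₀ := t) ht (e xlift) ?_
  rw [← (hsemi.iterate_right t).eq, hGx]
end
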